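/- arXiv:2605.00995 — 2 statements merged into one kernel-verified Lean document; each statement's English description precedes it below -/
import Mathlib

section
/- There exists an absolute constant c > 0 such that the following holds. Let r ≥ 1 be an integer, δ > 0, and let P₁,…,Pₙ : 𝔽₂^m → 𝔽₂ be functions with rank₁(P_i) ≤ r for all i ∈ [n]. Suppose that for every nonempty affine subspace V + h of 𝔽₂^m and every i ∈ [n], |Pr_{X ~ Unif(V+h)}[P_i(X) = 1] − 1/3| ≥ δ. Then ‖(P₁,…,Pₙ) − Ber(1/3)^⊗n‖_TV ≥ 1 − 2^{r − (c^r·δ^{2r}/r!)·n}. -/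
open Finset

/-- Distribution of `f(X)` on `β` for `X` uniform on the finite type `α`. -/
noncomputable def distOf {α β : Type*} [Fintype α] [DecidableEq β] (f : α → β) (y : β) : ℝ :=
  ((Finset.univ.filter fun x => f x = y).card : ℝ) / (Fintype.card α : ℝ)

/-- Output distribution on `𝔽₂ⁿ` of the tuple `(P₁(X),…,Pₙ(X))` for uniform `X ∈ 𝔽₂^m`. -/
noncomputable def outDist {m n : ℕ} (P : Fin n → (Fin m → ZMod 2) → ZMod 2) :
    (Fin n → ZMod 2) → ℝ :=
  distOf (fun x i => P i x)

/-- Total variation distance between two distributions on a finite type. -/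
noncomputable def tvDist {β : Type*} [Fintype β] (μ ν : β → ℝ) : ℝ :=
  (1 / 2) * ∑ y, |μ y - ν y|

/-- The distribution `Ber(1/3)^{⊗n}` on `𝔽₂ⁿ`. -/
noncomputable def ber13 {n : ℕ} (y : Fin n → ZMod 2) : ℝ :=
  (1 / 3 : ℝ) ^ (Finset.univ.filter fun i => y i = 1).card *
    (2 / 3 : ℝ) ^ (n - (Finset.univ.filter fun i => y i = 1).card)

/-- `P : 𝔽₂^m → 𝔽₂` has degree at most `d`. -/
def DegLE {m : ℕ} (d : ℕ) (P : (Fin m → ZMod 2) → ZMod 2) : Prop :=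
  ∃ p : MvPolynomial (Fin m) (ZMod 2), p.totalDegree ≤ d ∧ ∀ x, MvPolynomial.eval x p = P x

/-- `rank_{d'}(P) ≤ k`. -/
def RankLE {m : ℕ} (d' k : ℕ) (P : (Fin m → ZMod 2) → ZMod 2) : Prop :=
  ∃ (Q : Fin k → (Fin m → ZMod 2) → ZMod 2) (Γ : (Fin k → ZMod 2) → ZMod 2),
    (∀ j, DegLE d' (Q j)) ∧ ∀ x, P x = Γ (fun j => Q j x)

/-- `Pr_{X uniform}[P(X) = 1]`. -/
noncomputable def prOne {m : ℕ} (P : (Fin m → ZMod 2) → ZMod 2) : ℝ :=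
  distOf P 1

/-- `Pr_{X ~ Unif(S)}[P(X) = 1]` for a set `S ⊆ 𝔽₂^m`. -/
noncomputable def prOneOn {m : ℕ} (S : Set (Fin m → ZMod 2))
    (P : (Fin m → ZMod 2) → ZMod 2) : ℝ :=
  ({x ∈ S | P x = 1}.ncard : ℝ) / (S.ncard : ℝ)


noncomputable def bw (a : ZMod 2) : ℝ := if a = 1 then 1/3 else 2/3

lemma ber13_eq {n : ℕ} (y : Fin n → ZMod 2) : ber13 y = ∏ i, bw (y i) := by
  unfold ber13 bw
  rw [Finset.prod_ite, Finset.prod_const, Finset.prod_const]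
  congr 2
  have := Finset.card_filter_add_card_filter_not (s := (Finset.univ : Finset (Fin n))) (fun i => y i = 1)
  simp only [Finset.card_univ, Fintype.card_fin] at this
  omega

lemma z2sum (f : ZMod 2 → ℝ) : ∑ a, f a = f 0 + f 1 := Fin.sum_univ_two f

lemma sum_prod_fun {n : ℕ} (g : Fin n → ZMod 2 → ℝ) :
    ∑ y : Fin n → ZMod 2, ∏ i, g i (y i) = ∏ i, (g i 0 + g i 1) := by
  have := Finset.prod_univ_sum (fun _ : Fin n => (Finset.univ : Finset (ZMod 2))) g
  simp only [z2sum, Fintype.piFinset_univ] at this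
  exact this.symm

lemma ber_sum {n : ℕ} : ∑ y : Fin n → ZMod 2, ber13 y = 1 := by
  simp only [ber13_eq]
  rw [sum_prod_fun (fun _ => bw)]
  apply Finset.prod_eq_one
  intro i _
  simp [bw]; norm_num

lemma ber_nonneg {n : ℕ} (y : Fin n → ZMod 2) : 0 ≤ ber13 y := by
  unfold ber13; positivity

lemma distOf_nonneg {α β : Type*} [Fintype α] [DecidableEq β] (f : α → β) (y : β) :
    0 ≤ distOf f y := by unfold distOf; positivity

lemma dist_sum {α β : Type*} [Fintype α] [Fintype β] [DecidableEq β] (f : α → β) (g : β → ℝ) :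
    ∑ y, distOf f y * g y = (∑ x, g (f x)) / (Fintype.card α : ℝ) := by
  have : ∑ x, g (f x) = ∑ y, ((Finset.univ.filter fun x => f x = y).card : ℝ) * g y := by
    rw [← Finset.sum_fiberwise (s := Finset.univ) (g := f)]
    refine Finset.sum_congr rfl fun y _ => ?_
    rw [Finset.sum_congr rfl (g := fun _ => g y), Finset.sum_const, nsmul_eq_mul]
    intro x hx
    rw [(Finset.mem_filter.1 hx).2]
  rw [this, Finset.sum_div]
  refine Finset.sum_congr rfl fun y _ => ?_
  unfold distOf; ring

lemma dist_tot {α β : Type*} [Fintype α] [Nonempty α] [Fintype β] [DecidableEq β] (f : α → β) :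
    ∑ y, distOf f y = 1 := by
  have := dist_sum f (fun _ => 1)
  simp only [mul_one, Finset.sum_const, Finset.card_univ, nsmul_eq_mul] at this
  rw [this]
  exact div_self (by exact_mod_cast Fintype.card_ne_zero)

noncomputable def ovl {β : Type*} [Fintype β] (μ ν : β → ℝ) : ℝ := ∑ y, min (μ y) (ν y)

lemma tv_eq {β : Type*} [Fintype β] (μ ν : β → ℝ) (h1 : ∑ y, μ y = 1) (h2 : ∑ y, ν y = 1) :
    tvDist μ ν = 1 - ovl μ ν := by
  have : ∀ y, |μ y - ν y| = μ y + ν y - 2 * min (μ y) (ν y) := by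
    intro y
    rcases le_total (μ y) (ν y) with h | h
    · rw [min_eq_left h, abs_of_nonpos (by linarith)]; ring
    · rw [min_eq_right h, abs_of_nonneg (by linarith)]; ring
  unfold tvDist ovl
  simp only [this, Finset.sum_sub_distrib, Finset.sum_add_distrib, ← Finset.mul_sum, h1, h2]
  ring

lemma avg_surj {A B : Type*} [AddCommGroup A] [AddCommGroup B] [Fintype A] [Fintype B]
    (f : A →+ B) (hf : Function.Surjective f) (F : B → ℝ) :
    (∑ x, F (f x)) / (Fintype.card A : ℝ) = (∑ w, F w) / (Fintype.card B : ℝ) := by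
  have hA : (Fintype.card A : ℝ) ≠ 0 := by exact_mod_cast Fintype.card_ne_zero
  have hB : (Fintype.card B : ℝ) ≠ 0 := by exact_mod_cast Fintype.card_ne_zero
  rw [div_eq_div_iff hA hB]
  have h1 : ∑ a : A, ∑ w : B, F (w + f a) = (∑ w, F w) * Fintype.card A := by
    have : ∀ a : A, ∑ w : B, F (w + f a) = ∑ w, F w := fun a =>
      Equiv.sum_comp (Equiv.addRight (f a)) F
    simp only [this, Finset.sum_const, Finset.card_univ, nsmul_eq_mul]; ring
  have h2 : ∑ a : A, ∑ w : B, F (w + f a) = (∑ x, F (f x)) * Fintype.card B := by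
    rw [Finset.sum_comm]
    have : ∀ w : B, ∑ a : A, F (w + f a) = ∑ x, F (f x) := by
      intro w
      obtain ⟨s, rfl⟩ := hf w
      rw [← Equiv.sum_comp (Equiv.addLeft s) (fun x => F (f x))]
      simp
    simp only [this, Finset.sum_const, Finset.card_univ, nsmul_eq_mul]; ring
  rw [← h1, h2]

/-- test function bound -/
lemma one_coord (p δ : ℝ) (hδ : 0 ≤ δ) (h0 : 0 ≤ p) (h1 : p ≤ 1) (hd : δ ≤ |p - 1/3|) :
    ∃ g : ZMod 2 → ℝ, (∀ a, 0 < g a) ∧ (1 - p) * g 0 + p * g 1 ≤ (2:ℝ) ^ (-δ^2) ∧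
      bw 0 * (g 0)⁻¹ + bw 1 * (g 1)⁻¹ = 1 := by
  set q : ℝ := (p + 1/3)/2 with hq
  have q0 : 0 < q := by linarith
  have q1 : 0 < 1 - q := by linarith
  have hsq : δ^2 ≤ (p - 1/3)^2 := by
    rw [← sq_abs (p - 1/3)]; gcongr
  refine ⟨fun a => if a = 1 then (1/3)/q else (2/3)/(1-q), ?_, ?_, ?_⟩
  · intro a; dsimp only; split_ifs <;> positivity
  · have e : (1 - p) * ((2/3)/(1-q)) + p * ((1/3)/q) = 1 - (p-1/3)^2/4 * (1/(q*(1-q))) := by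
      have : p = 2*q - 1/3 := by rw [hq]; ring
      rw [this]
      field_simp
      ring
    have e2 : 4 ≤ 1/(q*(1-q)) := by
      rw [le_div_iff₀ (by positivity)]
      nlinarith [sq_nonneg (2*q-1)]
    have e3 : (1 - p) * ((2/3)/(1-q)) + p * ((1/3)/q) ≤ 1 - δ^2 := by
      rw [e]
      nlinarith [sq_nonneg (p-1/3)]
    have e4 : 1 - δ^2 ≤ (2:ℝ) ^ (-δ^2) := by
      have l2 := Real.log_two_lt_d9
      rw [Real.rpow_def_of_pos (by norm_num)]
      have := Real.add_one_le_exp (Real.log 2 * -δ^2)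
      nlinarith [sq_nonneg δ]
    simpa using e3.trans e4
  · simp [bw]
    field_simp
    ring

lemma keyA {n : ℕ} {V : Type} [AddCommGroup V] [Module (ZMod 2) V] [Fintype V]
    (W : Fin n → Type) [∀ i, AddCommGroup (W i)] [∀ i, Module (ZMod 2) (W i)]
    [∀ i, Fintype (W i)] (L : ∀ i, V →ₗ[ZMod 2] W i) (Γ : ∀ i, W i → ZMod 2)
    (P : Fin n → V → ZMod 2) (hP : ∀ i x, P i x = Γ i (L i x)) (δ : ℝ) (hδ : 0 ≤ δ)
    (hb : ∀ i, δ ≤ |distOf (P i) 1 - 1/3|) (T : Finset (Fin n))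
    (hT : Function.Surjective (LinearMap.pi (fun i : T => L i))) :
    ovl (distOf (fun x i => P i x)) ber13 ≤ (2:ℝ) ^ (-(δ^2/2) * (T.card : ℝ)) := by
  classical
  have hp0 : ∀ i, distOf (P i) 0 = 1 - distOf (P i) 1 := by
    intro i
    have := dist_tot (P i)
    rw [z2sum] at this; linarith
  have := fun i => one_coord (distOf (P i) 1) δ hδ (distOf_nonneg _ _)
    (by have := hp0 i; have := distOf_nonneg (P i) 0; linarith) (hb i)
  choose g gpos g1 g2 using this
  set G : (Fin n → ZMod 2) → ℝ := fun y => ∏ i ∈ T, g i (y i) with hG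
  have Gpos : ∀ y, 0 < G y := fun y => Finset.prod_pos fun i _ => gpos i _
  set lam : ℝ := (2:ℝ) ^ ((δ^2/2) * (T.card : ℝ)) with hlam
  have lpos : 0 < lam := by positivity
  have hLi : ∀ i ∈ T, Function.Surjective (L i) := by
    intro i hi w
    obtain ⟨x, hx⟩ := hT (Pi.single ⟨i, hi⟩ w)
    refine ⟨x, ?_⟩
    have := congrFun hx ⟨i, hi⟩
    simpa using this
  have coord : ∀ i, (∑ x, g i (P i x)) / (Fintype.card V : ℝ) ≤ (2:ℝ) ^ (-δ^2) := by
    intro i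
    rw [← dist_sum, z2sum, hp0]
    exact g1 i
  have EG : ∑ y, distOf (fun x i => P i x) y * G y ≤ (2:ℝ) ^ (-δ^2 * (T.card:ℝ)) := by
    rw [dist_sum]
    have e1 : ∀ x, G (fun i => P i x) =
        (fun w : ∀ i : T, W i => ∏ i : T, g i (Γ i (w i))) ((LinearMap.pi (fun i : T => L i)) x) := by
      intro x
      simp only [hG, LinearMap.pi_apply, ← hP]
      rw [Finset.prod_coe_sort T (fun i => g i (P i x))]
    simp only [e1]
    have e2 := avg_surj (LinearMap.pi (fun i : T => L i)).toAddMonoidHom hT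
      (fun w : ∀ i : T, W i => ∏ i : T, g i (Γ i (w i)))
    simp only [LinearMap.toAddMonoidHom_coe] at e2
    rw [e2]
    have e3 := Finset.prod_univ_sum (fun i : T => (Finset.univ : Finset (W i)))
      (fun i w => g i (Γ i w))
    rw [Fintype.piFinset_univ] at e3
    rw [← e3, Fintype.card_pi, Nat.cast_prod, ← Finset.prod_div_distrib]
    have e4 : ∀ i : T, (∑ w, g i (Γ i w)) / (Fintype.card (W i) : ℝ) ≤ (2:ℝ) ^ (-δ^2) := by
      intro i
      rw [← avg_surj (L i).toAddMonoidHom (hLi i i.2) (fun w => g i (Γ i w))]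
      simp only [LinearMap.toAddMonoidHom_coe, ← hP]
      exact coord i
    calc _ ≤ ∏ i : T, (2:ℝ) ^ (-δ^2) := by
          refine Finset.prod_le_prod ?_ fun i _ => e4 i
          intro i _
          exact div_nonneg (Finset.sum_nonneg fun w _ => (gpos _ _).le) (by positivity)
      _ = _ := by
          rw [Finset.prod_const, Finset.card_univ, Fintype.card_coe, ← Real.rpow_natCast,
            ← Real.rpow_mul (by norm_num)]
  have EN : ∑ y, ber13 y * (G y)⁻¹ = 1 := by
    have : ∀ y : Fin n → ZMod 2, ber13 y * (G y)⁻¹ =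
        ∏ i, (fun a => bw a * (if i ∈ T then (g i a)⁻¹ else 1)) (y i) := by
      intro y
      rw [ber13_eq, Finset.prod_mul_distrib]
      congr 1
      simp only [hG]
      rw [← Finset.prod_inv_distrib, Finset.prod_ite_mem, Finset.univ_inter]
    simp only [this]
    rw [sum_prod_fun (fun i a => bw a * (if i ∈ T then (g i a)⁻¹ else 1))]
    apply Finset.prod_eq_one
    intro i _
    by_cases hi : i ∈ T
    · simpa [hi] using g2 i
    · simp [hi, bw]; norm_num
  have pt : ∀ a b t : ℝ, 0 ≤ a → 0 ≤ b → 0 < t → min a b ≤ (a * t + b * t⁻¹) / 2 := by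
    intro a b t ha hb ht
    have hm1 := min_le_left a b
    have hm2 := min_le_right a b
    have hm : 0 ≤ min a b := le_min ha hb
    have h2 : 2 ≤ t + t⁻¹ := by
      have : t * t⁻¹ = 1 := mul_inv_cancel₀ ht.ne'
      nlinarith [sq_nonneg (t - 1), inv_pos.2 ht, sq_nonneg (t - t⁻¹), sq_nonneg (t+t⁻¹)]
    have h3 : min a b * t ≤ a * t := by gcongr
    have h4 : min a b * t⁻¹ ≤ b * t⁻¹ := by
      have := inv_pos.2 ht; gcongr
    nlinarith
  have hl1 : lam * (2:ℝ) ^ (-δ^2 * (T.card:ℝ)) = (2:ℝ) ^ (-(δ^2/2) * (T.card : ℝ)) := by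
    rw [hlam, ← Real.rpow_add (by norm_num)]; congr 1; ring
  have hl2 : lam⁻¹ = (2:ℝ) ^ (-(δ^2/2) * (T.card : ℝ)) := by
    rw [hlam, ← Real.rpow_neg (by norm_num)]; congr 1; ring
  calc ovl (distOf (fun x i => P i x)) ber13
      ≤ ∑ y, (lam * (distOf (fun x i => P i x) y * G y) + lam⁻¹ * (ber13 y * (G y)⁻¹)) / 2 := by
        refine Finset.sum_le_sum fun y _ => ?_
        refine (pt _ _ (lam * G y) (distOf_nonneg _ _) (ber_nonneg _) (mul_pos lpos (Gpos y))).trans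
          (le_of_eq ?_)
        rw [mul_inv]; ring
    _ = (lam * (∑ y, distOf (fun x i => P i x) y * G y) + lam⁻¹ * 1) / 2 := by
        rw [← Finset.sum_div, Finset.sum_add_distrib, ← Finset.mul_sum, ← Finset.mul_sum, EN]
    _ ≤ (lam * (2:ℝ) ^ (-δ^2 * (T.card:ℝ)) + lam⁻¹ * 1) / 2 := by gcongr
    _ = _ := by rw [hl1, mul_one, hl2]; ring

lemma keyB {n : ℕ} {V M : Type} [AddCommGroup V] [Module (ZMod 2) V] [Fintype V]
    [AddCommGroup M] [Module (ZMod 2) M] [Fintype M] (f : V →ₗ[ZMod 2] M)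
    (P : Fin n → V → ZMod 2) (s : M → V) (hs : ∀ w, f (s w) = w) [Fintype (LinearMap.ker f)]
    (B : ℝ)
    (h : ∀ w, ovl (distOf (fun (k : LinearMap.ker f) i => P i (s w + k))) ber13 ≤ B) :
    ovl (distOf (fun x i => P i x)) ber13 ≤ (Fintype.card M : ℝ) * B := by
  classical
  have hle : ∀ y, distOf (fun x i => P i x) y ≤
      ∑ w, distOf (fun (k : LinearMap.ker f) i => P i (s w + k)) y := by
    intro y
    unfold distOf
    rw [← Finset.sum_div]
    have hc : (Fintype.card (LinearMap.ker f) : ℝ) ≤ Fintype.card V := by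
      exact_mod_cast Fintype.card_le_of_injective _ (Subtype.val_injective)
    have hc0 : (0:ℝ) < Fintype.card (LinearMap.ker f) := by exact_mod_cast Fintype.card_pos
    gcongr
    rw [← Nat.cast_sum, Nat.cast_le, ← Finset.card_sigma]
    refine Finset.card_le_card_of_injOn
      (fun x => ⟨f x, ⟨x - s (f x), by simp [hs]⟩⟩) ?_ ?_
    · intro x hx
      simpa using hx
    · intro x _ x' _ hxx
      have h1 : f x = f x' := congrArg Sigma.fst hxx
      simp only [h1, Sigma.mk.injEq, heq_eq_eq, true_and, Subtype.mk.injEq] at hxx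
      simpa using hxx
  calc ovl (distOf (fun x i => P i x)) ber13
      ≤ ∑ y, ∑ w, min (distOf (fun (k : LinearMap.ker f) i => P i (s w + k)) y) (ber13 y) := by
        refine Finset.sum_le_sum fun y _ => ?_
        by_cases hh : ∃ w, ber13 y ≤ distOf (fun (k : LinearMap.ker f) i => P i (s w + k)) y
        · obtain ⟨w, hw⟩ := hh
          refine (min_le_right _ _).trans ?_
          have := Finset.single_le_sum (f := fun w =>
            min (distOf (fun (k : LinearMap.ker f) i => P i (s w + k)) y) (ber13 y))
            (fun w _ => le_min (distOf_nonneg _ _) (ber_nonneg _)) (Finset.mem_univ w)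
          simp only [min_eq_right hw] at this
          exact this
        · push Not at hh
          refine (min_le_left _ _).trans ((hle y).trans ?_)
          refine Finset.sum_le_sum fun w _ => ?_
          rw [min_eq_left (hh w).le]
    _ = ∑ w, ovl (distOf (fun (k : LinearMap.ker f) i => P i (s w + k))) ber13 := by
        rw [Finset.sum_comm]; rfl
    _ ≤ ∑ w : M, B := Finset.sum_le_sum fun w _ => h w
    _ = _ := by simp

noncomputable def aa (δ : ℝ) (r : ℕ) : ℝ := (1/2) * ((1/4)^r * δ^(2*r) / (r.factorial : ℝ))

lemma aa_nonneg (δ : ℝ) (hδ : 0 < δ) (r : ℕ) : 0 ≤ aa δ r := by unfold aa; positivity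

lemma aa_succ (δ : ℝ) (r : ℕ) : aa δ (r+1) * (r+1) = aa δ r * (δ^2/4) := by
  unfold aa
  rw [Nat.factorial_succ]
  push_cast
  field_simp
  ring

lemma core (δ : ℝ) (hδ : 0 < δ) (hδ1 : δ ≤ 1) (n : ℕ) (r : ℕ) :
    ∀ (V : Type) [AddCommGroup V] [Module (ZMod 2) V] [Fintype V]
    (W : Fin n → Type) [∀ i, AddCommGroup (W i)] [∀ i, Module (ZMod 2) (W i)]
    [∀ i, Fintype (W i)] (L : ∀ i, V →ₗ[ZMod 2] W i) (Γ : ∀ i, W i → ZMod 2)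
    (P : Fin n → V → ZMod 2) (_ : ∀ i x, P i x = Γ i (L i x))
    (_ : ∀ i, Module.finrank (ZMod 2) (W i) ≤ r)
    (_ : ∀ i, ∀ (U : Type) [AddCommGroup U] [Module (ZMod 2) U] [Fintype U]
      (j : U →ₗ[ZMod 2] V) (_ : Function.Injective j) (v : V),
      δ ≤ |distOf (fun u => P i (v + j u)) 1 - 1/3|),
    ovl (distOf (fun x i => P i x)) ber13 ≤ (2:ℝ) ^ (-(aa δ r) * (n:ℝ)) := by
  classical
  induction r with
  | zero =>
    intro V _ _ _ W _ _ _ L Γ P hP hW hb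
    have hc : ∀ x, (fun i => P i x) = (fun i => P i 0) := by
      intro x; funext i
      rw [hP, hP]
      have : Subsingleton (W i) := Module.finrank_zero_iff.1 (Nat.le_zero.1 (hW i))
      rw [Subsingleton.elim (L i x) (L i 0)]
    have hbw : ∀ a, bw a ≤ 2/3 := by intro a; unfold bw; split_ifs <;> norm_num
    have hbw0 : ∀ a, 0 ≤ bw a := by intro a; unfold bw; split_ifs <;> norm_num
    calc _ ≤ ∑ y, distOf (fun x i => P i x) y * ber13 y := by
          refine Finset.sum_le_sum fun y _ => ?_
          by_cases hy : y = fun i => P i 0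
          · have : distOf (fun x i => P i x) y = 1 := by
              unfold distOf
              simp only [hc, hy, Finset.filter_true, Finset.card_univ]
              exact div_self (by exact_mod_cast Fintype.card_ne_zero)
            rw [this, one_mul]; exact min_le_right _ _
          · have : distOf (fun x i => P i x) y = 0 := by
              unfold distOf
              simp [hc, Ne.symm hy]
            rw [this, zero_mul]; exact min_le_left _ _
      _ = ber13 (fun i => P i 0) := by
          rw [dist_sum]
          simp only [hc, Finset.sum_const, Finset.card_univ, nsmul_eq_mul]
          field_simp
      _ ≤ (2/3)^n := by
          rw [ber13_eq]
          refine (Finset.prod_le_prod (fun i _ => hbw0 _) (fun i _ => hbw _)).trans ?_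
          rw [Finset.prod_const, Finset.card_univ, Fintype.card_fin]
      _ ≤ _ := by
          have : (2/3 : ℝ) ≤ (2:ℝ) ^ (-(1/2):ℝ) := by
            rw [Real.rpow_neg (by norm_num), ← Real.sqrt_eq_rpow,
              le_inv_comm₀ (by norm_num) (by positivity), Real.sqrt_le_left (by norm_num)]
            norm_num
          have e : -(aa δ 0) * (n:ℝ) = (-(1/2)) * n := by simp [aa]
          rw [e, Real.rpow_mul (by norm_num), Real.rpow_natCast]
          gcongr
  | succ r ih =>
    intro V _ _ _ W _ _ _ L Γ P hP hW hb
    obtain ⟨T, hT, hmax⟩ : ∃ T : Finset (Fin n),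
        Function.Surjective (LinearMap.pi (fun i : T => L i)) ∧
        ∀ T' : Finset (Fin n), Function.Surjective (LinearMap.pi (fun i : T' => L i)) →
          T'.card ≤ T.card := by
      have hne : (Finset.univ.filter (fun T : Finset (Fin n) =>
          Function.Surjective (LinearMap.pi (fun i : T => L i)))).Nonempty := by
        refine ⟨∅, ?_⟩
        simp only [Finset.mem_filter, Finset.mem_univ, true_and]
        intro w
        exact ⟨0, by funext i; exact absurd i.2 (Finset.notMem_empty _)⟩
      obtain ⟨T, hT, hm⟩ := Finset.exists_max_image _ (fun T => T.card) hne
      exact ⟨T, (Finset.mem_filter.1 hT).2, fun T' h' => hm T' (by simpa using h')⟩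
    by_cases hcase : aa δ (r+1) * n ≤ (δ^2/2) * T.card
    · refine (keyA W L Γ P hP δ hδ.le ?_ T hT).trans ?_
      · intro i
        have := hb i V LinearMap.id Function.injective_id 0
        simpa using this
      · apply Real.rpow_le_rpow_of_exponent_le (by norm_num)
        linarith
    · push Not at hcase
      set f := LinearMap.pi (fun i : T => L i) with hf
      choose s hs using hT
      have hrk : ∀ i, Module.finrank (ZMod 2) (LinearMap.range ((L i).comp (LinearMap.ker f).subtype)) ≤ r := by
        intro i
        by_cases hi : i ∈ T
        · have : (L i).comp (LinearMap.ker f).subtype = 0 := by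
            ext k
            have h1 : f k = 0 := k.2
            exact congrFun h1 ⟨i, hi⟩
          rw [this, LinearMap.range_zero, finrank_bot]
          exact Nat.zero_le _
        · by_contra hcon
          push Not at hcon
          have htop : LinearMap.range ((L i).comp (LinearMap.ker f).subtype) = ⊤ := by
            apply Submodule.eq_top_of_finrank_eq
            have := Submodule.finrank_le (LinearMap.range ((L i).comp (LinearMap.ker f).subtype))
            have := hW i
            omega
          have hsur := LinearMap.range_eq_top.1 htop
          have : (insert i T).card ≤ T.card := by
            apply hmax
            intro w
            obtain ⟨k, hk⟩ := hsur (w ⟨i, Finset.mem_insert_self _ _⟩ -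
              L i (s (fun j : T => w ⟨j, Finset.mem_insert_of_mem j.2⟩)))
            refine ⟨s (fun j : T => w ⟨j, Finset.mem_insert_of_mem j.2⟩) + k, ?_⟩
            funext ⟨j, hj⟩
            rcases Finset.mem_insert.1 hj with rfl | hjT
            · have : L j k = _ := hk
              simp [this]
            · have h1 : f k = 0 := k.2
              have h2 : L j k = 0 := congrFun h1 ⟨j, hjT⟩
              have h3 := congrFun (hs (fun j : T => w ⟨j, Finset.mem_insert_of_mem j.2⟩)) ⟨j, hjT⟩
              have h4 : L j (s (fun j : T => w ⟨j, Finset.mem_insert_of_mem j.2⟩)) = w ⟨j, hj⟩ := h3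
              simp [h2, h4]
          rw [Finset.card_insert_of_notMem hi] at this
          omega
      have hK := keyB f P s hs ((2:ℝ) ^ (-(aa δ r) * (n:ℝ))) (by
        intro w
        refine ih (LinearMap.ker f)
          (fun i => LinearMap.range ((L i).comp (LinearMap.ker f).subtype))
          (fun i => ((L i).comp (LinearMap.ker f).subtype).rangeRestrict)
          (fun i u => Γ i (L i (s w) + u)) (fun i k => P i (s w + k)) ?_ hrk ?_
        · intro i x
          rw [hP, map_add]
          rfl
        · intro i U _ _ _ j hj v
          have := hb i U ((LinearMap.ker f).subtype.comp j)
            (Subtype.val_injective.comp hj) (s w + v)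
          simpa [add_assoc] using this)
      refine hK.trans ?_
      have hcard : (Fintype.card (∀ i : T, W i) : ℝ) ≤ (2:ℝ) ^ (((r:ℝ)+1) * T.card) := by
        have : Fintype.card (∀ i : T, W i) ≤ 2 ^ ((r+1) * T.card) := by
          rw [Fintype.card_pi, pow_mul]
          refine (Finset.prod_le_prod' (g := fun _ => 2^(r+1)) fun i _ => ?_).trans ?_
          · rw [Module.card_eq_pow_finrank (K := ZMod 2), ZMod.card]
            exact Nat.pow_le_pow_right (by norm_num) (hW i)
          · simp
        have h2 : (Fintype.card (∀ i : T, W i) : ℝ) ≤ (2:ℝ) ^ ((r+1) * T.card) := by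
          exact_mod_cast this
        refine h2.trans (le_of_eq ?_)
        rw [← Real.rpow_natCast]; push_cast; rfl
      calc _ ≤ (2:ℝ) ^ (((r:ℝ)+1) * T.card) * (2:ℝ) ^ (-(aa δ r) * (n:ℝ)) := by gcongr
        _ = (2:ℝ) ^ (((r:ℝ)+1) * T.card + -(aa δ r) * (n:ℝ)) := by
            rw [← Real.rpow_add (by norm_num)]
        _ ≤ _ := by
            apply Real.rpow_le_rpow_of_exponent_le (by norm_num)
            have h1 := aa_succ δ r
            have h0 := aa_nonneg δ hδ r
            have h0' := aa_nonneg δ hδ (r+1)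
            have d2 : 0 < δ^2 := by positivity
            have d21 : δ^2 ≤ 1 := by nlinarith
            have hn : (0:ℝ) ≤ n := by positivity
            have hr : (0:ℝ) ≤ r := by positivity
            have h3 : δ^2/2 * (((r:ℝ)+1) * T.card) ≤ δ^2/2 * (aa δ r * n / 2) := by
              have : ((r:ℝ)+1) * (δ^2/2 * T.card) ≤ ((r:ℝ)+1) * (aa δ (r+1) * n) := by gcongr
              calc _ = ((r:ℝ)+1) * (δ^2/2 * T.card) := by ring
                _ ≤ _ := this
                _ = (aa δ (r+1) * (r+1)) * n := by ring
                _ = _ := by rw [h1]; ring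
            have h4 := le_of_mul_le_mul_left h3 (by positivity)
            have h5 : aa δ (r+1) ≤ aa δ r / 2 := by nlinarith [mul_nonneg h0' hr]
            have h6 : aa δ (r+1) * n ≤ aa δ r / 2 * n := by gcongr
            linarith

lemma deg_one {m : ℕ} (Q : (Fin m → ZMod 2) → ZMod 2) (h : DegLE 1 Q) :
    ∃ (l : (Fin m → ZMod 2) →ₗ[ZMod 2] ZMod 2) (c : ZMod 2), ∀ x, Q x = l x + c := by
  obtain ⟨p, hp, hQ⟩ := h
  have key : ∀ x y z : Fin m → ZMod 2, Q (x + y) + Q 0 = Q x + Q y := by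
    intro x y z
    simp only [← hQ, MvPolynomial.eval_eq]
    rw [← Finset.sum_add_distrib, ← Finset.sum_add_distrib]
    refine Finset.sum_congr rfl fun d hd => ?_
    have hd1 : d.degree ≤ 1 := (MvPolynomial.le_totalDegree hd).trans hp
    rcases Nat.le_one_iff_eq_zero_or_eq_one.1 hd1 with h0 | h1
    · have : d = 0 := (Finsupp.degree_eq_zero_iff d).1 h0
      subst this; simp
    · obtain ⟨i, rfl⟩ : ∃ i, d = Finsupp.single i 1 := by
        have hne : d ≠ 0 := by rintro rfl; simp at h1
        obtain ⟨i, hi⟩ := Finsupp.ne_iff.1 hne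
        have hi0 : d i ≠ 0 := hi
        have h2 : Finsupp.single i 1 ≤ d := by
          rw [Finsupp.single_le_iff]; omega
        have h3 : d.degree = (Finsupp.single i 1).degree + (d - Finsupp.single i 1).degree := by
          rw [← map_add, add_tsub_cancel_of_le h2]
        rw [h1, Finsupp.degree_single] at h3
        have h4 : (d - Finsupp.single i 1).degree = 0 := by omega
        have h5 := (Finsupp.degree_eq_zero_iff _).1 h4
        refine ⟨i, ?_⟩
        rw [← add_tsub_cancel_of_le h2, h5, add_zero]
      classical
      rw [Finsupp.support_single_ne_zero _ one_ne_zero]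
      simp [mul_add]
  let φ : (Fin m → ZMod 2) →+ ZMod 2 :=
    AddMonoidHom.mk' (fun x => Q x - Q 0) (by
      intro x y
      have := key x y 0
      linear_combination this)
  refine ⟨φ.toZModLinearMap 2, Q 0, fun x => ?_⟩
  simp [φ]

/-- lower bound against bounded linear rank distributions, assuming each
coordinate is `δ`-far from `Ber(1/3)` on every (nonempty) affine subspace. -/
theorem bounded_linear_rank_lower_bound :
    ∃ c > (0:ℝ), ∀ r : ℕ, 1 ≤ r → ∀ δ : ℝ, 0 < δ → ∀ m n : ℕ,
      ∀ P : Fin n → (Fin m → ZMod 2) → ZMod 2,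
        (∀ i, RankLE 1 r (P i)) →
        (∀ i, ∀ (V : Submodule (ZMod 2) (Fin m → ZMod 2)) (h : Fin m → ZMod 2),
          |prOneOn ((fun v => v + h) '' (V : Set (Fin m → ZMod 2))) (P i) - 1/3| ≥ δ) →
        tvDist (outDist P) ber13 ≥
          1 - (2:ℝ) ^ ((r:ℝ) - (c ^ r * δ ^ (2*r) / (r.factorial : ℝ)) * (n:ℝ)) := by
  refine ⟨1/8, by norm_num, ?_⟩
  intro r hr δ hδ m n P hrank hb
  rw [tv_eq (outDist P) ber13 (dist_tot (fun x i => P i x)) ber_sum]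
  have hcc : (1/8:ℝ) ^ r * δ ^ (2*r) / (r.factorial : ℝ) ≤ aa δ r := by
    unfold aa
    have h1 : (1/8:ℝ)^r = (1/2)^r * (1/4)^r := by rw [← mul_pow]; norm_num
    have h2 : (1/2:ℝ)^r ≤ 1/2 := by
      calc (1/2:ℝ)^r ≤ (1/2)^1 := pow_le_pow_of_le_one (by norm_num) (by norm_num) hr
        _ = _ := by norm_num
    rw [h1, mul_assoc, mul_div_assoc]
    gcongr
  suffices hs : ovl (outDist P) ber13 ≤ (2:ℝ) ^ (-(aa δ r) * (n:ℝ)) by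
    have : (2:ℝ) ^ (-(aa δ r) * (n:ℝ)) ≤
        (2:ℝ) ^ ((r:ℝ) - ((1/8) ^ r * δ ^ (2*r) / (r.factorial : ℝ)) * (n:ℝ)) := by
      apply Real.rpow_le_rpow_of_exponent_le (by norm_num)
      have hn : (0:ℝ) ≤ n := by positivity
      have hr : (0:ℝ) ≤ r := by positivity
      have := mul_le_mul_of_nonneg_right hcc hn
      linarith
    linarith
  have hb' : ∀ i, ∀ (U : Type) [AddCommGroup U] [Module (ZMod 2) U] [Fintype U]
      (j : U →ₗ[ZMod 2] (Fin m → ZMod 2)) (_ : Function.Injective j) (v : Fin m → ZMod 2),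
      δ ≤ |distOf (fun u => P i (v + j u)) 1 - 1/3| := by
    intro i U _ _ _ j hj v
    have := hb i (LinearMap.range j) v
    have hinj : Function.Injective (fun u => v + j u) := fun a b hab => hj (by simpa using hab)
    have e : ((fun x => x + v) '' (LinearMap.range j : Set (Fin m → ZMod 2))) =
        Set.range (fun u => v + j u) := by
      ext x; constructor
      · rintro ⟨_, ⟨u, rfl⟩, rfl⟩; exact ⟨u, add_comm _ _⟩
      · rintro ⟨u, rfl⟩; exact ⟨_, ⟨u, rfl⟩, add_comm _ _⟩
    have e2 : {x ∈ Set.range (fun u => v + j u) | P i x = 1} =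
        (fun u => v + j u) '' {u | P i (v + j u) = 1} := by
      ext x; constructor
      · rintro ⟨⟨u, rfl⟩, h⟩; exact ⟨u, h, rfl⟩
      · rintro ⟨u, h, rfl⟩; exact ⟨⟨u, rfl⟩, h⟩
    have e3 : prOneOn ((fun x => x + v) '' (LinearMap.range j : Set (Fin m → ZMod 2))) (P i) =
        distOf (fun u => P i (v + j u)) 1 := by
      unfold prOneOn distOf
      rw [e, e2, Set.ncard_image_of_injective _ hinj, ← Set.image_univ,
        Set.ncard_image_of_injective _ hinj, Set.ncard_univ, Nat.card_eq_fintype_card,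
        Set.ncard_eq_toFinset_card']
      congr 3
      ext u; simp
    rw [e3] at this
    exact this
  rcases Nat.eq_zero_or_pos n with rfl | hn
  · simp only [Nat.cast_zero, mul_zero, Real.rpow_zero]
    rw [← ber_sum (n := 0)]
    exact Finset.sum_le_sum fun y _ => min_le_right _ _
  have hδ1 : δ ≤ 1 := by
    have h := hb' ⟨0, hn⟩ _ LinearMap.id Function.injective_id 0
    simp only [LinearMap.id_coe, id_eq, zero_add] at h
    have h1 := dist_tot (P ⟨0, hn⟩)
    rw [z2sum] at h1
    have h2 := distOf_nonneg (P ⟨0, hn⟩) 0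
    have h3 := distOf_nonneg (P ⟨0, hn⟩) 1
    refine h.trans (abs_le.2 ⟨by linarith, by linarith⟩)
  choose Q Γ hQ hPQ using hrank
  choose l c hl using fun i j => deg_one (Q i j) (hQ i j)
  refine core δ hδ hδ1 n r (Fin m → ZMod 2) (fun _ => Fin r → ZMod 2)
    (fun i => LinearMap.pi (l i)) (fun i w => Γ i (fun j => w j + c i j)) P ?_ ?_ hb'
  · intro i x
    rw [hPQ]
    congr 1
    funext j
    rw [hl]; rfl
  · intro i; simp
end

section
/- There exist absolute constants C > 0 and c > 0 such that the following holds. For all positive integers m, n, r and all functions P₁,…,Pₙ : 𝔽₂^m → 𝔽₂ with rank₁(P_i) ≤ r for all i ∈ [n], ‖(P₁,…,Pₙ) − Ber(1/3)^⊗n‖_TV ≥ 1 − 2^{−c·2^{−C·r²}·n}. -/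
open Finset

namespace BLR

noncomputable def nu1 (b : ZMod 2) : ℝ := if b = 1 then 1/3 else 2/3

lemma sum_zmod2 (g : ZMod 2 → ℝ) : ∑ b, g b = g 0 + g 1 := by
  exact Fin.sum_univ_two g

lemma ber13_eq {n : ℕ} (y : Fin n → ZMod 2) : ber13 y = ∏ i, nu1 (y i) := by
  unfold ber13 nu1
  rw [Finset.prod_ite]
  simp only [Finset.prod_const]
  congr 2
  have := Finset.card_filter_add_card_filter_not (s := (Finset.univ : Finset (Fin n))) (fun i => y i = 1)
  simp only [Finset.card_univ, Fintype.card_fin] at this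
  omega

lemma sum_prod {n : ℕ} (g : Fin n → ZMod 2 → ℝ) :
    ∑ y : Fin n → ZMod 2, ∏ i, g i (y i) = ∏ i, (g i 0 + g i 1) := by
  simp_rw [← sum_zmod2]
  rw [Finset.prod_univ_sum]
  simp

lemma ber13_nonneg {n : ℕ} (y : Fin n → ZMod 2) : 0 ≤ ber13 y := by
  unfold ber13; positivity

lemma ber13_sum (n : ℕ) : ∑ y : Fin n → ZMod 2, ber13 y = 1 := by
  simp_rw [ber13_eq]
  rw [sum_prod (fun _ => nu1)]
  simp [nu1]; norm_num

lemma distOf_expect {α β : Type*} [Fintype α] [Fintype β] [DecidableEq β] (f : α → β) (h : β → ℝ) :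
    ∑ y, distOf f y * h y = (∑ x, h (f x)) / Fintype.card α := by
  unfold distOf
  simp_rw [div_mul_eq_mul_div]
  rw [← Finset.sum_div]
  congr 1
  rw [← Finset.sum_fiberwise (s := Finset.univ) (g := f)]
  refine Finset.sum_congr rfl fun y _ => ?_
  rw [Finset.sum_congr rfl (g := fun _ => h y)]
  · simp
  · intro x hx; rw [(Finset.mem_filter.1 hx).2]

lemma distOf_nonneg {α β : Type*} [Fintype α] [DecidableEq β] (f : α → β) (y : β) :
    0 ≤ distOf f y := by unfold distOf; positivity

lemma distOf_sum {α β : Type*} [Fintype α] [Nonempty α] [Fintype β] [DecidableEq β] (f : α → β) :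
    ∑ y, distOf f y = 1 := by
  have := distOf_expect f (fun _ => 1)
  simpa using this

noncomputable def ov {E : Type} [Fintype E] {n : ℕ} (f : Fin n → E → ZMod 2) : ℝ :=
  ∑ y, min (distOf (fun x i => f i x) y) (ber13 y)

lemma min_le_half {a b h : ℝ} (ha : 0 ≤ a) (hb : 0 ≤ b) (hh : 0 < h) :
    min a b ≤ (a * h + b * h⁻¹) / 2 := by
  have key : min a b * h + min a b * h⁻¹ ≤ a * h + b * h⁻¹ := by
    gcongr
    · exact min_le_left _ _
    · exact min_le_right _ _
  have h2 : 2 ≤ h + h⁻¹ := by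
    have : h + h⁻¹ - 2 = (h-1)^2 / h := by field_simp; ring
    have : 0 ≤ (h-1)^2/h := by positivity
    linarith
  have : 0 ≤ min a b := le_min ha hb
  nlinarith

lemma indep_pair {E : Type} [AddCommGroup E] [Fintype E] (K U : AddSubgroup E) (hKU : U ⊔ K = ⊤)
    (F G : E → ℝ) (hF : ∀ x, ∀ k ∈ K, F (x + k) = F x) (hG : ∀ x, ∀ u ∈ U, G (x + u) = G x) :
    (∑ x, F x * G x) * Fintype.card E = (∑ x, F x) * (∑ x, G x) := by
  have key : ∀ d, ∑ x, F x * G (x + d) = ∑ x, F x * G x := by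
    intro d
    have hd : d ∈ U ⊔ K := by rw [hKU]; trivial
    obtain ⟨u, hu, k, hk, rfl⟩ := AddSubgroup.mem_sup.1 hd
    rw [← Equiv.sum_comp (Equiv.addRight k) (fun x => F x * G x)]
    refine Finset.sum_congr rfl fun x _ => ?_
    simp only [Equiv.coe_addRight]
    rw [hF x k hk, show x + (u + k) = (x + k) + u by abel, hG _ u hu]
  have : ∑ d, ∑ x, F x * G (x + d) = (∑ x, F x) * (∑ x, G x) := by
    rw [Finset.sum_comm, Finset.sum_mul]
    refine Finset.sum_congr rfl fun x _ => ?_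
    rw [← Finset.mul_sum]
    congr 1
    exact Equiv.sum_comp (Equiv.addLeft x) G
  rw [← this]
  simp_rw [key]
  simp [mul_comm]

inductive Ind {E : Type} [AddCommGroup E] {n : ℕ} (U : Fin n → AddSubgroup E) :
    Finset (Fin n) → Prop
  | empty : Ind U ∅
  | insert (S : Finset (Fin n)) (j : Fin n) : Ind U S → j ∉ S → U j ⊔ S.inf U = ⊤ →
      Ind U (insert j S)

lemma exists_max_ind {E : Type} [AddCommGroup E] {n : ℕ} (U : Fin n → AddSubgroup E) :
    ∃ S, Ind U S ∧ ∀ j, j ∉ S → U j ⊔ S.inf U ≠ ⊤ := by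
  classical
  obtain ⟨S, hS, hmax⟩ := Finset.exists_max_image
    ((Finset.univ : Finset (Finset (Fin n))).filter (fun S => Ind U S)) Finset.card
    ⟨∅, by simp [Ind.empty]⟩
  simp only [Finset.mem_filter, Finset.mem_univ, true_and] at hS hmax
  refine ⟨S, hS, fun j hj h => ?_⟩
  have := hmax _ (Ind.insert S j hS hj h)
  rw [Finset.card_insert_of_notMem hj] at this
  omega

lemma inv_prod {E : Type} [AddCommGroup E] {n : ℕ} (U : Fin n → AddSubgroup E)
    (f : Fin n → E → ZMod 2) (hf : ∀ i x, ∀ u ∈ U i, f i (x + u) = f i x)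
    (h : Fin n → ZMod 2 → ℝ) (S : Finset (Fin n)) (x k : E) (hk : k ∈ S.inf U) :
    ∏ i ∈ S, h i (f i (x + k)) = ∏ i ∈ S, h i (f i x) := by
  refine Finset.prod_congr rfl fun i hi => ?_
  rw [hf i x k ((Finset.inf_le hi : S.inf U ≤ U i) hk)]

lemma ind_prod {E : Type} [AddCommGroup E] [Fintype E] {n : ℕ} (U : Fin n → AddSubgroup E)
    (f : Fin n → E → ZMod 2) (hf : ∀ i x, ∀ u ∈ U i, f i (x + u) = f i x)
    (h : Fin n → ZMod 2 → ℝ) (S : Finset (Fin n)) (hS : Ind U S) :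
    (∑ x, ∏ i ∈ S, h i (f i x)) / Fintype.card E
      = ∏ i ∈ S, ((∑ x, h i (f i x)) / Fintype.card E) := by
  have hE : (Fintype.card E : ℝ) ≠ 0 := by simp
  induction hS with
  | empty => simp
  | insert S j hS hj hU ih =>
    simp_rw [Finset.prod_insert hj]
    rw [← ih]
    have := indep_pair (S.inf U) (U j) hU (fun x => ∏ i ∈ S, h i (f i x)) (fun x => h j (f j x))
      (fun x k hk => inv_prod U f hf h S x k hk) (fun x u hu => by rw [hf j x u hu])
    field_simp
    simp_rw [mul_comm (h j _)]
    rw [this, mul_comm]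

lemma sum_coset {E : Type} [AddCommGroup E] [Fintype E] (K : AddSubgroup E) [Fintype K]
    [Fintype (E ⧸ K)] {M : Type} [AddCommMonoid M] (F : E → M) :
    ∑ x, F x = ∑ q : E ⧸ K, ∑ k : K, F (q.out + k) := by
  rw [← Fintype.sum_prod_type']
  symm
  refine Fintype.sum_bijective (fun p : (E ⧸ K) × K => p.1.out + (p.2 : E)) ?_ _ _ (fun _ => rfl)
  constructor
  · rintro ⟨q, k⟩ ⟨q', k'⟩ h
    simp only at h
    have h1 : q = q' := by
      have := congrArg (fun x : E => (x : E ⧸ K)) h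
      simpa [QuotientAddGroup.mk_add_of_mem] using this
    subst h1
    simpa using h
  · intro x
    refine ⟨((x : E ⧸ K), ⟨-(x : E ⧸ K).out + x, ?_⟩), by simp⟩
    rw [← QuotientAddGroup.eq]
    simp

/-- bias is dyadic hence away from 1/3 -/
lemma bias {E : Type} [AddCommGroup E] [Fintype E] (m r : ℕ) (hm : Nat.card E = 2 ^ m)
    (U : AddSubgroup E) (hU : U.index ≤ 2 ^ r) (f : E → ZMod 2)
    (hf : ∀ x, ∀ u ∈ U, f (x + u) = f x) :
    (1/3 : ℝ) * (1/2) ^ r ≤ |1/3 - distOf f 1| := by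
  classical
  have h1 : (Finset.univ.filter fun x => f x = 1).card
      = (Finset.univ.filter fun q : E ⧸ U => f q.out = 1).card * Nat.card U := by
    rw [Finset.card_filter, sum_coset U]
    have : ∀ (q : E ⧸ U) (k : U), f (q.out + k) = f q.out := fun q k => hf _ _ k.2
    simp_rw [this]
    rw [Finset.card_filter]
    rw [Finset.sum_mul]
    simp only [Finset.sum_const, Finset.card_univ, smul_eq_mul, Nat.card_eq_fintype_card]
    exact Finset.sum_congr rfl fun q _ => mul_comm _ _
  have hdvd : U.index ∣ 2 ^ m := hm ▸ U.index_dvd_card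
  obtain ⟨k, -, hk⟩ := (Nat.dvd_prime_pow Nat.prime_two).1 hdvd
  have hkr : k ≤ r := by
    rw [hk] at hU
    exact (Nat.pow_le_pow_iff_right (by norm_num)).1 hU
  have hc : Nat.card U * U.index = Nat.card E := U.card_mul_index
  set j := (Finset.univ.filter fun q : E ⧸ U => f q.out = 1).card
  have hUpos : (Nat.card U : ℝ) ≠ 0 := by simp [Nat.card_eq_fintype_card]
  have hp : distOf f 1 = j / 2 ^ k := by
    unfold distOf
    rw [h1, ← Nat.card_eq_fintype_card, ← hc, hk]
    push_cast
    field_simp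
  rw [hp]
  have hne : (2:ℤ) ^ k - 3 * j ≠ 0 := by
    intro h
    have h3 : 2 ^ k = 3 * j := by zify; linarith
    have : 3 ∣ 2 ^ k := ⟨j, h3⟩
    have := (Nat.prime_dvd_prime_iff_eq Nat.prime_three Nat.prime_two).1
      (Nat.prime_three.dvd_of_dvd_pow this)
    omega
  have habs : (1:ℝ) ≤ |(2:ℝ) ^ k - 3 * j| := by exact_mod_cast Int.one_le_abs hne
  have e : (1/3 : ℝ) - j / 2 ^ k = (1/3) * (1/2)^k * (2 ^ k - 3 * j) := by
    rw [one_div_pow]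
    field_simp
  rw [e, abs_mul, abs_of_pos (by positivity : (0:ℝ) < 1/3 * (1/2)^k)]
  have : ((1:ℝ)/2) ^ r ≤ (1/2) ^ k := pow_le_pow_of_le_one (by norm_num) (by norm_num) hkr
  have h0 : (0:ℝ) < (1/2)^k := by positivity
  nlinarith

/-- the test function -/
noncomputable def hh (p : ℝ) (b : ZMod 2) : ℝ :=
  1 + (1/3 - p) / 8 * ((if b = 1 then 1 else 0) - (p + 1/3) / 2)

lemma hh_pos {p : ℝ} (hp0 : 0 ≤ p) (hp1 : p ≤ 1) (b : ZMod 2) : 0 < hh p b := by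
  unfold hh
  split_ifs <;> nlinarith

lemma inv_bound {z : ℝ} (hz : |z| ≤ 1/2) : (1 + z)⁻¹ ≤ 1 - z + 2 * z ^ 2 := by
  have := abs_le.1 hz
  rw [inv_le_iff_one_le_mul₀ (by linarith)]
  nlinarith [sq_nonneg z]

lemma hh_inv {p : ℝ} (hp0 : 0 ≤ p) (hp1 : p ≤ 1) :
    nu1 0 * (hh p 0)⁻¹ + nu1 1 * (hh p 1)⁻¹ ≤ 1 - (1/3 - p)^2 / 32 := by
  have a0 : (hh p 0)⁻¹ ≤ 1 - ((1/3 - p) / 8 * (0 - (p + 1/3) / 2)) + 2 * ((1/3 - p) / 8 * (0 - (p + 1/3) / 2))^2 := by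
    have := @inv_bound ((1/3 - p) / 8 * (0 - (p + 1/3) / 2)) (by rw [abs_le]; constructor <;> nlinarith)
    simpa [hh] using this
  have a1 : (hh p 1)⁻¹ ≤ 1 - ((1/3 - p) / 8 * (1 - (p + 1/3) / 2)) + 2 * ((1/3 - p) / 8 * (1 - (p + 1/3) / 2))^2 := by
    have := @inv_bound ((1/3 - p) / 8 * (1 - (p + 1/3) / 2)) (by rw [abs_le]; constructor <;> nlinarith)
    simpa [hh] using this
  have n0 : nu1 0 = 2/3 := by simp [nu1]
  have n1 : nu1 1 = 1/3 := by simp [nu1]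
  rw [n0, n1]
  have b0 : (0 - (p+1/3)/2)^2 ≤ 1 := by nlinarith
  have b1 : (1 - (p+1/3)/2)^2 ≤ 1 := by nlinarith
  have s : 0 ≤ (1/3 - p)^2 := sq_nonneg _
  have c0 := mul_le_mul_of_nonneg_left b0 s
  have c1 := mul_le_mul_of_nonneg_left b1 s
  nlinarith

lemma hh_mean {E : Type} [AddCommGroup E] [Fintype E] (f : E → ZMod 2) :
    (∑ x, hh (distOf f 1) (f x)) / Fintype.card E = 1 - (1/3 - distOf f 1)^2 / 16 := by
  rw [← distOf_expect, sum_zmod2]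
  have h := distOf_sum f
  rw [sum_zmod2] at h
  have : distOf f 0 = 1 - distOf f 1 := by linarith
  rw [this]
  simp [hh]
  ring

lemma ov_ind {E : Type} [AddCommGroup E] [Fintype E] {n : ℕ} (m r : ℕ) (hm : Nat.card E = 2 ^ m)
    (U : Fin n → AddSubgroup E) (hU : ∀ i, (U i).index ≤ 2 ^ r)
    (f : Fin n → E → ZMod 2) (hf : ∀ i x, ∀ u ∈ U i, f i (x + u) = f i x)
    (S : Finset (Fin n)) (hS : Ind U S) :
    ov f ≤ (1 - (1/4 : ℝ) ^ r / 288) ^ S.card := by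
  set p : Fin n → ℝ := fun i => distOf (f i) 1 with hp
  have hp0 : ∀ i, 0 ≤ p i := fun i => distOf_nonneg _ _
  have hp1 : ∀ i, p i ≤ 1 := fun i => by
    have h := distOf_sum (f i)
    rw [sum_zmod2] at h
    have := distOf_nonneg (f i) 0
    simp only [hp]; linarith
  have hη : ∀ i, (1/4:ℝ)^r / 9 ≤ (1/3 - p i)^2 := fun i => by
    have h := bias m r hm (U i) (hU i) (f i) (hf i)
    have h2 : ((1/3:ℝ) * (1/2)^r)^2 ≤ |1/3 - p i|^2 := by
      gcongr
    rw [sq_abs, mul_pow, ← pow_mul, mul_comm r 2, pow_mul] at h2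
    norm_num at h2 ⊢
    linarith
  have hup : ∀ i, (1/3 - p i)^2 ≤ 1 := fun i => by nlinarith [hp0 i, hp1 i]
  set H : (Fin n → ZMod 2) → ℝ := fun y => ∏ i ∈ S, hh (p i) (y i) with hH
  have hHpos : ∀ y, 0 < H y := fun y => Finset.prod_pos fun i _ => hh_pos (hp0 i) (hp1 i) _
  have A : ∑ y, distOf (fun x i => f i x) y * H y ≤ (1 - (1/4 : ℝ) ^ r / 288) ^ S.card := by
    rw [distOf_expect]
    simp only [hH]
    rw [ind_prod U f hf (fun i => hh (p i)) S hS, ← Finset.prod_const]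
    refine Finset.prod_le_prod ?_ ?_
    · intro i _
      have := fun x => (hh_pos (hp0 i) (hp1 i) (f i x)).le
      exact div_nonneg (Finset.sum_nonneg fun x _ => this x) (Nat.cast_nonneg _)
    · intro i _
      rw [hh_mean]
      have := hη i
      have := sq_nonneg (1/3 - p i)
      simp only [hp] at *
      linarith
  have B : ∑ y, ber13 y * (H y)⁻¹ ≤ (1 - (1/4 : ℝ) ^ r / 288) ^ S.card := by
    have e : ∀ y : Fin n → ZMod 2, ber13 y * (H y)⁻¹
        = ∏ i, (nu1 (y i) * if i ∈ S then (hh (p i) (y i))⁻¹ else 1) := by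
      intro y
      rw [ber13_eq, Finset.prod_mul_distrib, Finset.prod_ite_mem, Finset.univ_inter]
      simp [hH]
    simp_rw [e]
    rw [sum_prod (fun i b => nu1 b * if i ∈ S then (hh (p i) b)⁻¹ else 1), ← Finset.prod_const]
    rw [← Finset.prod_subset (Finset.subset_univ S)]
    · refine Finset.prod_le_prod ?_ ?_
      · intro i hi
        have h0 := hh_pos (hp0 i) (hp1 i) 0
        have h1 := hh_pos (hp0 i) (hp1 i) 1
        have hn : ∀ b, 0 ≤ nu1 b := fun b => by unfold nu1; split_ifs <;> norm_num
        have := hn 0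
        have := hn 1
        simp only [hi, if_true]
        positivity
      · intro i hi
        simp only [hi, if_true]
        have := hh_inv (hp0 i) (hp1 i)
        have := hη i
        linarith
    · intro i _ hi
      simp [hi, nu1]; norm_num
  calc ov f ≤ ∑ y, (distOf (fun x i => f i x) y * H y + ber13 y * (H y)⁻¹) / 2 :=
        Finset.sum_le_sum fun y _ => min_le_half (distOf_nonneg _ _) (ber13_nonneg _) (hHpos y)
    _ = (∑ y, distOf (fun x i => f i x) y * H y + ∑ y, ber13 y * (H y)⁻¹) / 2 := by
        rw [← Finset.sum_div, Finset.sum_add_distrib]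
    _ ≤ _ := by linarith

lemma min_sum_le {ι : Type*} (s : Finset ι) (a : ι → ℝ) (b : ℝ) (ha : ∀ i, 0 ≤ a i) (hb : 0 ≤ b) :
    min (∑ i ∈ s, a i) b ≤ ∑ i ∈ s, min (a i) b := by
  classical
  induction s using Finset.induction_on with
  | empty => simp [hb]
  | insert i s hi ih =>
    rw [Finset.sum_insert hi, Finset.sum_insert hi]
    have h0 : 0 ≤ ∑ i ∈ s, a i := Finset.sum_nonneg fun i _ => ha i
    have := ha i
    rcases min_cases (a i + ∑ i ∈ s, a i) b with h | h <;>
    rcases min_cases (∑ i ∈ s, a i) b with h' | h' <;>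
    rcases min_cases (a i) b with h'' | h'' <;> linarith

lemma ov_restrict {E : Type} [AddCommGroup E] [Fintype E] {n : ℕ} (f : Fin n → E → ZMod 2)
    (K : AddSubgroup E) [Fintype K] (B : ℝ)
    (hB : ∀ x : E, ov (fun i (k : K) => f i (x + k)) ≤ B) :
    ov f ≤ K.index * B := by
  classical
  have e : ∀ y, distOf (fun x i => f i x) y
      ≤ ∑ q : E ⧸ K, distOf (fun (k : K) i => f i (q.out + k)) y := by
    intro y
    unfold distOf
    rw [Finset.card_filter, sum_coset K, ← Finset.sum_div]
    simp_rw [← Finset.card_filter]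
    push_cast
    gcongr
    exact Fintype.card_subtype_le _
  calc ov f ≤ ∑ y, ∑ q : E ⧸ K, min (distOf (fun (k : K) i => f i (q.out + k)) y) (ber13 y) := by
        refine Finset.sum_le_sum fun y _ => ?_
        refine le_trans (min_le_min_right _ (e y)) ?_
        exact min_sum_le _ _ _ (fun q => distOf_nonneg _ _) (ber13_nonneg _)
    _ = ∑ q : E ⧸ K, ov (fun i (k : K) => f i (q.out + k)) := by
        rw [Finset.sum_comm]; rfl
    _ ≤ ∑ q : E ⧸ K, B := Finset.sum_le_sum fun q _ => hB _
    _ = K.index * B := by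
        simp [AddSubgroup.index, Nat.card_eq_fintype_card]

lemma index_inf_bound {E : Type} [AddCommGroup E] {n : ℕ} (U : Fin n → AddSubgroup E) (r : ℕ)
    (hU : ∀ i, (U i).index ≤ 2 ^ r) (S : Finset (Fin n)) :
    (S.inf U).index ≤ 2 ^ (r * S.card) := by
  induction S using Finset.induction_on with
  | empty => simp
  | insert j S hj ih =>
    rw [Finset.inf_insert, Finset.card_insert_of_notMem hj, mul_add, mul_one, pow_add, mul_comm]
    exact AddSubgroup.index_inf_le.trans (Nat.mul_le_mul (hU j) ih)

lemma relIndex_drop {E : Type} [AddCommGroup E] [Finite E] (U K : AddSubgroup E) (r : ℕ)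
    (hU : U.index ≤ 2 ^ (r+1)) (h : U ⊔ K ≠ ⊤) : U.relIndex K ≤ 2 ^ r := by
  have h1 : U.relIndex (U ⊔ K) * (U ⊔ K).index = U.index :=
    AddSubgroup.relIndex_mul_index le_sup_left
  have h2 : U.relIndex (U ⊔ K) = U.relIndex K := by
    rw [sup_comm]; exact AddSubgroup.relIndex_sup_right ..
  have h3 : (U ⊔ K).index ≠ 1 := by rwa [Ne, AddSubgroup.index_eq_one]
  have h4 : (U ⊔ K).index ≠ 0 := AddSubgroup.index_ne_zero_of_finite
  have h5 : 2 ≤ (U ⊔ K).index := by omega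
  rw [h2] at h1
  rw [pow_succ] at hU
  nlinarith

noncomputable def aa (r : ℕ) : ℝ := (1/288) * (2:ℝ) ^ (-(13 * (r:ℝ)^2))

lemma aa_pos (r : ℕ) : 0 < aa r := by unfold aa; positivity

lemma aa_succ (r : ℕ) : aa (r+1) = aa r * (1/2) ^ (26 * r + 13) := by
  unfold aa
  rw [mul_assoc]
  congr 1
  have : ((1:ℝ)/2) ^ (26 * r + 13) = (2:ℝ) ^ (-((26 * r + 13 : ℕ) : ℝ)) := by
    rw [Real.rpow_neg (by norm_num), Real.rpow_natCast]; simp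
  rw [this, ← Real.rpow_add (by norm_num)]
  congr 1
  push_cast; ring

lemma aa_succ_le1 (r : ℕ) : aa (r+1) ≤ aa r / 2 := by
  rw [aa_succ]
  have : ((1:ℝ)/2) ^ (26 * r + 13) ≤ (1/2)^1 :=
    pow_le_pow_of_le_one (by norm_num) (by norm_num) (by omega)
  have := aa_pos r
  nlinarith

lemma aa_succ_le2 (r : ℕ) :
    aa (r+1) ≤ (1/4:ℝ)^(r+1) / 288 * (aa r / (2 * (r+1))) := by
  rw [aa_succ]
  have h1 : ((1:ℝ)/2) ^ (26 * r + 13) ≤ (1/2)^(2*(r+1) + 10 + r) :=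
    pow_le_pow_of_le_one (by norm_num) (by norm_num) (by omega)
  have h2 : ((r:ℝ)+1) ≤ 2^r := by exact_mod_cast Nat.lt_two_pow_self (n := r)
  have h3 : ((1:ℝ)/2)^r ≤ 1 / (r+1) := by
    rw [one_div_pow]; exact one_div_le_one_div_of_le (by positivity) h2
  have h4 : ((1:ℝ)/2)^(2*(r+1) + 10 + r) = (1/4)^(r+1) * (1/1024) * (1/2)^r := by
    rw [pow_add, pow_add, pow_mul]; norm_num
  have := aa_pos r
  calc aa r * (1/2) ^ (26 * r + 13) ≤ aa r * ((1/4)^(r+1) * (1/1024) * (1 / (r+1))) := by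
        gcongr
        rw [h4] at h1
        refine h1.trans ?_
        gcongr
    _ ≤ aa r * ((1/4)^(r+1) * (1/576) * (1 / (r+1))) := by
        gcongr
        norm_num
    _ = _ := by field_simp; norm_num

lemma pow_bound {δ : ℝ} (h0 : 0 ≤ δ) (h1 : δ ≤ 1) (s : ℕ) (t : ℝ) (ht : t ≤ δ * s) :
    (1 - δ) ^ s ≤ (2:ℝ) ^ (-t) := by
  have h2 : (1 - δ) ≤ (2:ℝ) ^ (-δ) := by
    have e : (2:ℝ) ^ (-δ) = Real.exp (Real.log 2 * (-δ)) := Real.rpow_def_of_pos (by norm_num) _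
    have := Real.add_one_le_exp (Real.log 2 * (-δ))
    have hl : Real.log 2 ≤ 1 := by linarith [Real.log_two_lt_d9]
    rw [e]
    nlinarith
  calc (1 - δ)^s ≤ ((2:ℝ) ^ (-δ))^s := by gcongr
    _ = (2:ℝ) ^ (-(δ * s)) := by rw [← Real.rpow_natCast, ← Real.rpow_mul (by norm_num)]; ring_nf
    _ ≤ _ := Real.rpow_le_rpow_of_exponent_le (by norm_num) (by linarith)

lemma main (n : ℕ) (r : ℕ) : ∀ (E : Type) [AddCommGroup E] [Fintype E] (m : ℕ)
    (_ : Nat.card E = 2 ^ m)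
    (U : Fin n → AddSubgroup E) (_ : ∀ i, (U i).index ≤ 2 ^ r)
    (f : Fin n → E → ZMod 2) (_ : ∀ i x, ∀ u ∈ U i, f i (x + u) = f i x),
    ov f ≤ (2:ℝ) ^ (-(aa r * n)) := by
  induction r with
  | zero =>
    intro E _ _ m hm U hU f hf
    obtain ⟨S, hS, hmax⟩ := exists_max_ind U
    have hSu : S = Finset.univ := by
      ext j
      simp only [Finset.mem_univ, iff_true]
      by_contra hj
      refine hmax j hj ?_
      have h1 := hU j
      have h4 : (U j).index ≠ 0 := AddSubgroup.index_ne_zero_of_finite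
      have : (U j).index = 1 := by simp at h1; omega
      rw [AddSubgroup.index_eq_one.1 this, top_sup_eq]
    have h := ov_ind m 0 hm U hU f hf S hS
    refine h.trans (pow_bound (by norm_num) (by norm_num) _ _ ?_)
    simp [hSu, aa]
  | succ r ih =>
    intro E _ _ m hm U hU f hf
    obtain ⟨S, hS, hmax⟩ := exists_max_ind U
    have ha := aa_pos r
    by_cases hcase : aa r / (2 * (r+1)) * n ≤ S.card
    · have h := ov_ind m (r+1) hm U hU f hf S hS
      have hq : ((1:ℝ)/4)^(r+1) ≤ 1 := pow_le_one₀ (by norm_num) (by norm_num)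
      refine h.trans (pow_bound (by positivity) (by linarith) _ _ ?_)
      calc aa (r+1) * n ≤ (1/4:ℝ)^(r+1) / 288 * (aa r / (2 * (r+1))) * n := by
            gcongr; exact aa_succ_le2 r
        _ = (1/4:ℝ)^(r+1) / 288 * (aa r / (2 * (r+1)) * n) := by ring
        _ ≤ _ := by gcongr
    · push Not at hcase
      classical
      set K := S.inf U with hK
      have hKcard : ∃ m', Nat.card K = 2 ^ m' := by
        have : Nat.card K ∣ 2 ^ m := hm ▸ AddSubgroup.card_addSubgroup_dvd_card K
        obtain ⟨k, -, hk⟩ := (Nat.dvd_prime_pow Nat.prime_two).1 this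
        exact ⟨k, hk⟩
      obtain ⟨m', hm'⟩ := hKcard
      have h1 := ov_restrict f K ((2:ℝ) ^ (-(aa r * n))) (by
        intro x
        refine ih K m' hm' (fun i => (U i).addSubgroupOf K) ?_ _ ?_
        · intro i
          change (U i).relIndex K ≤ 2 ^ r
          by_cases hi : i ∈ S
          · have : K ≤ U i := Finset.inf_le hi
            rw [AddSubgroup.relIndex_eq_one.2 this]
            exact Nat.one_le_two_pow
          · exact relIndex_drop _ _ r (hU i) (hmax i hi)
        · intro i k u hu
          rw [AddSubgroup.mem_addSubgroupOf] at hu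
          have := hf i (x + k) u hu
          simpa [add_assoc] using this)
      have h2 : (K.index : ℝ) ≤ (2:ℝ) ^ (((r+1) * S.card : ℕ) : ℝ) := by
        rw [Real.rpow_natCast]
        exact_mod_cast index_inf_bound U (r+1) hU S
      calc ov f ≤ K.index * (2:ℝ) ^ (-(aa r * n)) := h1
        _ ≤ (2:ℝ) ^ (((r+1) * S.card : ℕ) : ℝ) * (2:ℝ) ^ (-(aa r * n)) := by gcongr
        _ = (2:ℝ) ^ ((((r+1) * S.card : ℕ) : ℝ) + (-(aa r * n))) := by
            rw [← Real.rpow_add (by norm_num)]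
        _ ≤ _ := by
            refine Real.rpow_le_rpow_of_exponent_le (by norm_num) ?_
            push_cast
            have h3 : ((r:ℝ)+1) * S.card ≤ aa r / 2 * n := by
              calc ((r:ℝ)+1) * S.card ≤ (r+1) * (aa r / (2 * (r+1)) * n) := by gcongr
                _ = _ := by field_simp
            have h4 := mul_le_mul_of_nonneg_right (aa_succ_le1 r) (Nat.cast_nonneg (α := ℝ) n)
            linarith

lemma degLE_add {m : ℕ} {Q : (Fin m → ZMod 2) → ZMod 2} (h : DegLE 1 Q) (x y : Fin m → ZMod 2) :
    Q (x + y) - Q 0 = (Q x - Q 0) + (Q y - Q 0) := by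
  obtain ⟨p, hp, hQ⟩ := h
  simp_rw [← hQ, MvPolynomial.eval_eq']
  rw [← Finset.sum_sub_distrib, ← Finset.sum_sub_distrib, ← Finset.sum_sub_distrib,
    ← Finset.sum_add_distrib]
  refine Finset.sum_congr rfl fun d hd => ?_
  have hd1 : d.degree ≤ 1 := by
    have := MvPolynomial.le_totalDegree hd
    rw [Finsupp.degree_eq_sum]
    rw [Finsupp.sum_fintype _ _ (by simp)] at this
    exact this.trans hp
  rcases Nat.le_one_iff_eq_zero_or_eq_one.1 hd1 with h0 | h1
  · rw [Finsupp.degree_eq_zero_iff] at h0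
    simp [h0]
  · have h2 : d ∈ Set.range (fun a : Fin m => Finsupp.single a 1) := by
      rw [Finsupp.range_single_one]; exact h1
    obtain ⟨i, rfl⟩ := h2
    have : ∀ z : Fin m → ZMod 2, ∏ j, z j ^ (Finsupp.single i 1 j) = z i := by
      intro z
      rw [Finset.prod_eq_single i] <;> simp +contextual [Finsupp.single_apply, eq_comm]
    simp_rw [this]
    simp [mul_add]

lemma rank_sub {m r : ℕ} {P : (Fin m → ZMod 2) → ZMod 2} (h : RankLE 1 r P) :
    ∃ U : AddSubgroup (Fin m → ZMod 2), U.index ≤ 2 ^ r ∧ ∀ x, ∀ u ∈ U, P (x + u) = P x := by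
  obtain ⟨Q, Γ, hQ, hP⟩ := h
  let φ : (Fin m → ZMod 2) →+ (Fin r → ZMod 2) :=
    AddMonoidHom.mk' (fun x j => Q j x - Q j 0) (fun x y => by
      ext j; exact degLE_add (hQ j) x y)
  refine ⟨φ.ker, ?_, ?_⟩
  · rw [AddSubgroup.index_ker]
    calc Nat.card φ.range ≤ Nat.card (Fin r → ZMod 2) := AddSubgroup.card_le_card_addGroup _
      _ = 2 ^ r := by simp
  · intro x u hu
    rw [hP, hP]
    congr 1
    ext j
    have h1 : Q j u - Q j 0 = 0 := congrFun (AddMonoidHom.mem_ker.1 hu) j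
    have h2 := degLE_add (hQ j) x u
    rw [h1, add_zero] at h2
    exact sub_left_inj.1 h2

lemma tv_eq {β : Type*} [Fintype β] (μ ν : β → ℝ) (h1 : ∑ y, μ y = 1) (h2 : ∑ y, ν y = 1) :
    tvDist μ ν = 1 - ∑ y, min (μ y) (ν y) := by
  unfold tvDist
  have : ∀ y, |μ y - ν y| = μ y + ν y - 2 * min (μ y) (ν y) := by
    intro y
    rcases le_total (μ y) (ν y) with h | h
    · rw [min_eq_left h, abs_of_nonpos (by linarith)]; ring
    · rw [min_eq_right h, abs_of_nonneg (by linarith)]; ring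
  simp_rw [this]
  rw [Finset.sum_sub_distrib, Finset.sum_add_distrib, h1, h2, ← Finset.mul_sum]
  ring

end BLR

/-- bounded linear rank distributions are
`1 - 2^{-c·2^{-C r²}·n}`-far from `Ber(1/3)^{⊗n}`. -/
theorem bounded_linear_rank_lower_bound' :
    ∃ C > (0:ℝ), ∃ c > (0:ℝ), ∀ m n r : ℕ, 0 < m → 0 < n → 0 < r →
      ∀ P : Fin n → (Fin m → ZMod 2) → ZMod 2, (∀ i, RankLE 1 r (P i)) →
        tvDist (outDist P) ber13 ≥
          1 - (2:ℝ) ^ (-(c * (2:ℝ) ^ (-(C * (r:ℝ)^2)) * (n:ℝ))) := by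
  refine ⟨13, by norm_num, 1/288, by norm_num, ?_⟩
  intro m n r _ _ _ P hP
  choose U hU hf using fun i => BLR.rank_sub (hP i)
  have h := BLR.main n r (Fin m → ZMod 2) m (by simp) U hU P hf
  unfold outDist
  rw [BLR.tv_eq _ _ (BLR.distOf_sum _) (BLR.ber13_sum n)]
  unfold BLR.ov BLR.aa at h
  linarith
end
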